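/- arXiv:2301.13765 — 3 statements merged into one kernel-verified Lean document; each statement's English description precedes it below -/
import Mathlib

section
/- Let X and Y be compact metric spaces. Then every two continuous maps f, g : X → 2^Y_u into the hyperspace of Y with the upper semifinite topology are homotopic, i.e., there exists a continuous map H : X × [0,1] → 2^Y_u with H(x,0) = f(x) and H(x,1) = g(x) for all x ∈ X. -/
open Metric Set Filter Topology

/-- The hyperspace of nonempty closed subsets of a topological space. -/
structure Hyper (Y : Type*) [TopologicalSpace Y] where
  carrier : Set Y
  nonempty' : carrier.Nonempty
  closed' : IsClosed carrier

/-- The upper semifinite topology on the hyperspace: it has as a base the sets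
`B(U) = {C : C ⊆ U}` for `U` open in `Y`. -/
instance Hyper.instTopologicalSpace (Y : Type*) [TopologicalSpace Y] :
    TopologicalSpace (Hyper Y) :=
  TopologicalSpace.generateFrom
    {S | ∃ U : Set Y, IsOpen U ∧ S = {C : Hyper Y | C.carrier ⊆ U}}

/-- The canonical copy of a point in the hyperspace. -/
def Hyper.singleton {Y : Type*} [TopologicalSpace Y] [T1Space Y] (y : Y) : Hyper Y :=
  ⟨{y}, Set.singleton_nonempty y, isClosed_singleton⟩

/-- The nearest-point (multivalued) map `q_A` into the hyperspace. -/
noncomputable def nearestMap {X : Type*} [MetricSpace X] (A : Finset X) (hA : A.Nonempty)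
    (x : X) : Hyper X :=
  ⟨{a | a ∈ A ∧ dist x a = infDist x (A : Set X)},
    by
      obtain ⟨a, haA, ha⟩ := A.finite_toSet.isCompact.exists_infDist_eq_dist
        (Finset.coe_nonempty.mpr hA) x
      exact ⟨a, haA, ha.symm⟩,
    (A.finite_toSet.subset fun a ha => Finset.mem_coe.mpr ha.1).isClosed⟩

/-- The sets `B(U)` are open in the upper semifinite topology. -/
theorem Hyper.isOpen_setOf_subset {Y : Type*} [TopologicalSpace Y] {U : Set Y}
    (hU : IsOpen U) : IsOpen {C : Hyper Y | C.carrier ⊆ U} :=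
  TopologicalSpace.isOpen_generateFrom_of_mem ⟨U, hU, rfl⟩

/-- Any two continuous maps from a compact metric space into the hyperspace of another
compact metric space with the upper semifinite topology are homotopic. -/
theorem all_hyperspace_maps_homotopic
    (X Y : Type*) [MetricSpace X] [CompactSpace X] [MetricSpace Y] [CompactSpace Y]
    (f g : X → Hyper Y) (hf : Continuous f) (hg : Continuous g) :
    ∃ H : X × unitInterval → Hyper Y, Continuous H ∧
      (∀ x, H (x, 0) = f x) ∧ (∀ x, H (x, 1) = g x) := by
  have hne (x : X) : (univ : Set Y).Nonempty := (f x).nonempty'.mono (subset_univ _)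
  -- Follow `f` before time `1 / 2` and `g` after it, passing through the whole space.
  let H : X × unitInterval → Hyper Y := fun p =>
    if (p.2 : ℝ) < 1 / 2 then f p.1
    else if 1 / 2 < (p.2 : ℝ) then g p.1
    else ⟨univ, hne p.1, isClosed_univ⟩
  refine ⟨H, continuous_generateFrom_iff.mpr ?_, fun x => ?_, fun x => ?_⟩
  · rintro _ ⟨U, hU, rfl⟩
    by_cases hUniv : U = univ
    · simp [hUniv]
    have ht : Continuous fun p : X × unitInterval => (p.2 : ℝ) := by fun_prop
    have hf' := (Hyper.isOpen_setOf_subset hU).preimage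
      (hf.comp (continuous_fst (Y := unitInterval)))
    have hg' := (Hyper.isOpen_setOf_subset hU).preimage
      (hg.comp (continuous_fst (Y := unitInterval)))
    convert ((isOpen_lt ht (continuous_const (y := (1 / 2 : ℝ)))).inter hf').union
      ((isOpen_lt (continuous_const (y := (1 / 2 : ℝ))) ht).inter hg') using 1
    ext p
    change (H p).carrier ⊆ U ↔
      (p.2 : ℝ) < 1 / 2 ∧ (f p.1).carrier ⊆ U ∨ 1 / 2 < (p.2 : ℝ) ∧ (g p.1).carrier ⊆ U
    rcases lt_trichotomy (p.2 : ℝ) (1 / 2) with h | h | h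
    · simp only [H, h, h.not_gt, if_true, true_and, false_and, or_false]
    · simp only [H, h, lt_irrefl, if_false, univ_subset_iff, hUniv, false_and, or_false]
    · simp only [H, h, h.not_gt, if_true, if_false, true_and, false_and, false_or]
  · simp [H]
  · have h : ¬ (1 : ℝ) < 2⁻¹ := by norm_num
    have h' : (2⁻¹ : ℝ) < 1 := by norm_num
    simp [H, h, h']
end

section
/- Let X and Y be compact metric spaces and let {f_n} be an approximative map from X to Y. Then there exists an approximative map {𝔣_n} from X to Y of finite type (i.e., 𝔣_n(x) is a finite set for every n and every x ∈ X) that is homotopic to {f_n}. -/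
open Metric Set Filter Topology

/-- `f` and `g` are homotopic within `U ⊆ 2^Y_u`. -/
def HomotopicIn {X Y : Type*} [TopologicalSpace X] [TopologicalSpace Y]
    (f g : X → Hyper Y) (U : Set (Hyper Y)) : Prop :=
  ∃ H : X × unitInterval → Hyper Y, Continuous H ∧
    (∀ x, H (x, 0) = f x) ∧ (∀ x, H (x, 1) = g x) ∧ (∀ p, H p ∈ U)

/-- An approximative map from `X` to `Y`: a sequence of continuous maps `f n : X → 2^Y_u`
such that, for every open neighborhood `U` of the canonical copy of `Y` in `2^Y_u`,
eventually `f n` is homotopic to `f (n+1)` within `U`. -/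
def IsApproximativeMap {X Y : Type*} [TopologicalSpace X] [TopologicalSpace Y] [T1Space Y]
    (f : ℕ → X → Hyper Y) : Prop :=
  (∀ n, Continuous (f n)) ∧
  ∀ U : Set (Hyper Y), IsOpen U → (∀ y : Y, Hyper.singleton y ∈ U) →
    ∃ n₀ : ℕ, ∀ n, n₀ ≤ n → HomotopicIn (f n) (f (n + 1)) U

/-- Two approximative maps are homotopic when, for every open neighborhood `U` of the
canonical copy of `Y` in `2^Y_u`, eventually `f n` is homotopic to `g n` within `U`. -/
def ApproximativelyHomotopic {X Y : Type*} [TopologicalSpace X] [TopologicalSpace Y]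
    [T1Space Y] (f g : ℕ → X → Hyper Y) : Prop :=
  ∀ U : Set (Hyper Y), IsOpen U → (∀ y : Y, Hyper.singleton y ∈ U) →
    ∃ n₀ : ℕ, ∀ n, n₀ ≤ n → HomotopicIn (f n) (g n) U

namespace Hyper

variable {X Y : Type*} [TopologicalSpace X]

theorem ext [TopologicalSpace Y] {C D : Hyper Y} (h : C.carrier = D.carrier) : C = D := by
  cases C
  cases D
  congr

theorem isOpen_setOf_carrier_subset [TopologicalSpace Y] {V : Set Y} (hV : IsOpen V) :
    IsOpen {C : Hyper Y | C.carrier ⊆ V} :=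
  TopologicalSpace.isOpen_generateFrom_of_mem ⟨V, hV, rfl⟩

theorem continuous_iff [TopologicalSpace Y] {f : X → Hyper Y} :
    Continuous f ↔ ∀ V : Set Y, IsOpen V → IsOpen {x | (f x).carrier ⊆ V} := by
  refine ⟨fun hf V hV ↦ (isOpen_setOf_carrier_subset hV).preimage hf, fun h ↦ ?_⟩
  refine continuous_generateFrom_iff.2 ?_
  rintro _ ⟨V, hV, rfl⟩
  exact h V hV

/-- An open set containing a closed set `C` as a point contains a basic neighborhood of `C`. -/
theorem exists_isOpen_of_mem [TopologicalSpace Y] {U : Set (Hyper Y)} (hU : IsOpen U)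
    {C : Hyper Y} (hC : C ∈ U) :
    ∃ V : Set Y, IsOpen V ∧ C.carrier ⊆ V ∧ ∀ D : Hyper Y, D.carrier ⊆ V → D ∈ U := by
  induction hU with
  | basic S hS =>
    obtain ⟨V, hV, rfl⟩ := hS
    exact ⟨V, hV, hC, fun _ hD ↦ hD⟩
  | univ => exact ⟨univ, isOpen_univ, subset_univ _, fun _ _ ↦ mem_univ _⟩
  | inter S T _ _ ihS ihT =>
    obtain ⟨V, hV, hCV, hVS⟩ := ihS hC.1
    obtain ⟨W, hW, hCW, hWT⟩ := ihT hC.2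
    exact ⟨V ∩ W, hV.inter hW, subset_inter hCV hCW,
      fun D hD ↦ ⟨hVS D (hD.trans inter_subset_left), hWT D (hD.trans inter_subset_right)⟩⟩
  | sUnion 𝒮 _ ih =>
    obtain ⟨S, hS, hCS⟩ := hC
    obtain ⟨V, hV, hCV, hVS⟩ := ih S hS hCS
    exact ⟨V, hV, hCV, fun D hD ↦ ⟨S, hS, hVS D hD⟩⟩

/-- A neighborhood of the canonical copy of a compact metric space contains all sufficiently
small closed sets. -/
theorem exists_forall_subset_ball_mem [MetricSpace Y] [CompactSpace Y] {U : Set (Hyper Y)}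
    (hU : IsOpen U) (hs : ∀ y : Y, singleton y ∈ U) :
    ∃ ε > 0, ∀ (C : Hyper Y) (y : Y), C.carrier ⊆ ball y ε → C ∈ U := by
  choose V hV hyV hVU using fun y ↦ exists_isOpen_of_mem hU (hs y)
  obtain ⟨ε, hε, h⟩ := lebesgue_number_lemma_of_metric (isCompact_univ (X := Y)) hV
    fun y _ ↦ mem_iUnion.2 ⟨y, hyV y rfl⟩
  refine ⟨ε, hε, fun C y hC ↦ ?_⟩
  obtain ⟨i, hi⟩ := h y (mem_univ y)
  exact hVU i C (hC.trans hi)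

/-- The closed sets contained in some ball of radius `ε`. -/
def smallSets (Y : Type*) [MetricSpace Y] (ε : ℝ) : Set (Hyper Y) :=
  ⋃ y : Y, {C | C.carrier ⊆ ball y ε}

theorem isOpen_smallSets [MetricSpace Y] (ε : ℝ) : IsOpen (smallSets Y ε) :=
  isOpen_iUnion fun _ ↦ isOpen_setOf_carrier_subset isOpen_ball

theorem singleton_mem_smallSets [MetricSpace Y] {ε : ℝ} (hε : 0 < ε) (y : Y) :
    singleton y ∈ smallSets Y ε :=
  mem_iUnion.2 ⟨y, singleton_subset_iff.2 (mem_ball_self hε)⟩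

/-- The points of a finite `ε`-net `A` at distance at most `ε` from a closed set. -/
def netApprox [MetricSpace Y] (A : Set Y) (hA : A.Finite) (ε : ℝ)
    (hcover : ∀ y, ∃ a ∈ A, dist y a ≤ ε) (C : Hyper Y) : Hyper Y where
  carrier := {a ∈ A | ∃ y ∈ C.carrier, dist y a ≤ ε}
  nonempty' := by
    obtain ⟨y, hy⟩ := C.nonempty'
    obtain ⟨a, ha, hya⟩ := hcover y
    exact ⟨a, ha, y, hy, hya⟩
  closed' := (hA.subset fun _ h ↦ h.1).isClosed

theorem continuous_netApprox [MetricSpace Y] (A : Set Y) (hA : A.Finite) (ε : ℝ)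
    (hcover : ∀ y, ∃ a ∈ A, dist y a ≤ ε) : Continuous (netApprox A hA ε hcover) := by
  refine continuous_iff.2 fun V _ ↦ ?_
  have hW : IsOpen (⋂ a ∈ A \ V, {y | ε < dist y a}) :=
    (hA.subset sdiff_subset).isOpen_biInter fun a _ ↦
      isOpen_lt continuous_const (continuous_id.dist continuous_const)
  convert isOpen_setOf_carrier_subset hW using 1
  ext C
  simp only [netApprox, mem_ofPred_eq, subset_def, mem_iInter, Set.mem_sdiff]
  constructor
  · intro h y hy a ha
    by_contra hlt
    exact ha.2 (h a ⟨ha.1, y, hy, not_lt.1 hlt⟩)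
  · rintro h a ⟨haA, y, hy, hya⟩
    by_contra haV
    exact (h y hy a ⟨haA, haV⟩).not_ge hya

/-- For every positive `ε` there is a continuous self-map of the hyperspace with finite values
moving no closed set by more than `ε`. -/
theorem exists_finite_approx (Y : Type*) [MetricSpace Y] [CompactSpace Y] {ε : ℝ} (hε : 0 < ε) :
    ∃ q : Hyper Y → Hyper Y, Continuous q ∧ (∀ C, (q C).carrier.Finite) ∧
      ∀ C, ∀ a ∈ (q C).carrier, ∃ y ∈ C.carrier, dist y a ≤ ε := by
  obtain ⟨A, -, hA, hcover⟩ := finite_cover_balls_of_compact (isCompact_univ (X := Y)) hε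
  refine ⟨netApprox A hA ε fun y ↦ ?_, continuous_netApprox .., fun C ↦ hA.subset fun _ h ↦ h.1,
    fun C a ha ↦ ha.2⟩
  obtain ⟨a, ha, hya⟩ := mem_iUnion₂.1 (hcover (mem_univ y))
  exact ⟨a, ha, (mem_ball.1 hya).le⟩

end Hyper

namespace HomotopicIn

variable {X Y : Type*} [TopologicalSpace X] [TopologicalSpace Y] {f g h : X → Hyper Y}
  {U : Set (Hyper Y)}

theorem iff_homotopicWith (hf : Continuous f) (hg : Continuous g) :
    HomotopicIn f g U ↔
      ContinuousMap.HomotopicWith ⟨f, hf⟩ ⟨g, hg⟩ fun φ ↦ ∀ x, φ x ∈ U := by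
  constructor
  · rintro ⟨H, hH, h0, h1, hU⟩
    exact ⟨{
      toFun := fun p ↦ H (p.2, p.1)
      continuous_toFun := hH.comp continuous_swap
      map_zero_left := h0
      map_one_left := h1
      prop' := fun t x ↦ hU (x, t) }⟩
  · rintro ⟨F⟩
    exact ⟨fun p ↦ F (p.2, p.1), F.continuous.comp continuous_swap, F.apply_zero, F.apply_one,
      fun p ↦ F.prop p.2 p.1⟩

theorem symm (hf : Continuous f) (hg : Continuous g) (H : HomotopicIn f g U) :
    HomotopicIn g f U :=
  (iff_homotopicWith hg hf).2 ((iff_homotopicWith hf hg).1 H).symm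

theorem trans (hf : Continuous f) (hg : Continuous g) (hh : Continuous h)
    (H : HomotopicIn f g U) (K : HomotopicIn g h U) : HomotopicIn f h U :=
  (iff_homotopicWith hf hh).2
    (((iff_homotopicWith hf hg).1 H).trans ((iff_homotopicWith hg hh).1 K))

/-- Two continuous maps are homotopic through their union. -/
theorem of_union (hf : Continuous f) (hg : Continuous g)
    (hU : ∀ x (C : Hyper Y), C.carrier ⊆ (f x).carrier ∪ (g x).carrier → C ∈ U) :
    HomotopicIn f g U := by
  let F : X × unitInterval → Set Y := fun p ↦
    {y | (p.2 : ℝ) ≤ 1 / 2 ∧ y ∈ (f p.1).carrier ∨ 1 / 2 ≤ (p.2 : ℝ) ∧ y ∈ (g p.1).carrier}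
  refine ⟨fun p ↦ ⟨F p, ?_, ?_⟩, ?_, fun x ↦ ?_, fun x ↦ ?_, fun p ↦ ?_⟩
  · obtain ⟨y, hy⟩ := (f p.1).nonempty'
    obtain ⟨z, hz⟩ := (g p.1).nonempty'
    rcases le_total (p.2 : ℝ) (1 / 2) with h | h
    exacts [⟨y, .inl ⟨h, hy⟩⟩, ⟨z, .inr ⟨h, hz⟩⟩]
  · exact (isClosed_const.inter (f p.1).closed').union (isClosed_const.inter (g p.1).closed')
  · refine Hyper.continuous_iff.2 fun V hV ↦ ?_
    have ht : Continuous fun p : X × unitInterval ↦ (p.2 : ℝ) :=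
      continuous_subtype_val.comp continuous_snd
    have hf' := (Hyper.continuous_iff.1 hf V hV).preimage (continuous_fst (Y := unitInterval))
    have hg' := (Hyper.continuous_iff.1 hg V hV).preimage (continuous_fst (Y := unitInterval))
    convert ((isOpen_lt (continuous_const (y := (1 / 2 : ℝ))) ht).union hf').inter
      ((isOpen_lt ht (continuous_const (y := (1 / 2 : ℝ)))).union hg') using 1
    ext p
    simp only [F, mem_ofPred_eq, subset_def, mem_inter_iff, mem_union, mem_preimage, ← not_le]
    grind
  · refine Hyper.ext (Set.ext fun y ↦ ?_)
    norm_num [F]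
  · refine Hyper.ext (Set.ext fun y ↦ ?_)
    norm_num [F]
  · exact hU p.1 _ fun y hy ↦ hy.imp And.right And.right

end HomotopicIn


/-- Every approximative map between compact metric spaces is homotopic to an
approximative map of finite type (one all of whose values are finite sets). -/
theorem exists_finite_type_approximative_map
    (X Y : Type*) [MetricSpace X] [CompactSpace X] [MetricSpace Y] [CompactSpace Y]
    (f : ℕ → X → Hyper Y) (hf : IsApproximativeMap f) :
    ∃ g : ℕ → X → Hyper Y, IsApproximativeMap g ∧
      (∀ n x, (g n x).carrier.Finite) ∧ ApproximativelyHomotopic f g := by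
  choose q hq hfin hdist using fun n : ℕ ↦
    Hyper.exists_finite_approx Y (Nat.one_div_pos_of_nat (α := ℝ) (n := n))
  have hg (n : ℕ) : Continuous (q n ∘ f n) := (hq n).comp (hf.1 n)
  have hfg : ApproximativelyHomotopic f fun n ↦ q n ∘ f n := by
    intro U hU hs
    obtain ⟨ε, hε, hεU⟩ := Hyper.exists_forall_subset_ball_mem hU hs
    obtain ⟨N, hN⟩ := exists_nat_one_div_lt (half_pos hε)
    obtain ⟨M, hM⟩ := hf.2 _ (Hyper.isOpen_smallSets (ε / 2))
      (Hyper.singleton_mem_smallSets (half_pos hε))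
    refine ⟨max M N, fun n hn ↦ .of_union (hf.1 n) (hg n) fun x C hC ↦ ?_⟩
    obtain ⟨H, -, h0, -, hH⟩ := hM n (le_of_max_le_left hn)
    obtain ⟨y, hy⟩ := mem_iUnion.1 (h0 x ▸ hH (x, 0))
    refine hεU C y (hC.trans (union_subset ?_ fun a ha ↦ ?_))
    · exact Subset.trans hy (ball_subset_ball (half_le_self hε.le))
    · obtain ⟨z, hz, hza⟩ := hdist n (f n x) a ha
      have hzy : dist z y < ε / 2 := hy hz
      have hnN := Nat.one_div_le_one_div (α := ℝ) (le_of_max_le_right hn)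
      have := dist_triangle_left a y z
      exact mem_ball.2 (by linarith)
  refine ⟨fun n ↦ q n ∘ f n, ⟨hg, fun U hU hs ↦ ?_⟩, fun n x ↦ hfin n _, hfg⟩
  obtain ⟨N, hN⟩ := hfg U hU hs
  obtain ⟨M, hM⟩ := hf.2 U hU hs
  refine ⟨max M N, fun n hn ↦ ?_⟩
  have hnN := le_of_max_le_right hn
  exact ((hN n hnN).symm (hf.1 n) (hg n)).trans (hg n) (hf.1 n) (hg (n + 1))
    ((hM n (le_of_max_le_left hn)).trans (hf.1 n) (hf.1 (n + 1)) (hg (n + 1))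
      (hN (n + 1) (hnN.trans n.le_succ)))
end

section
/- Let X be a compact metric space with an adjusted approximative sequence {ε_n, A_n}, nearest-point maps q_{A_n} : X → 2^X_u given by q_{A_n}(x) = {a ∈ A_n : d(x, a) = d(x, A_n)}, and bonding maps p_{n,n+1} sending a nonempty subset C ⊆ A_{n+1} to p_{n,n+1}(C) = {a ∈ A_n : there exists c ∈ C with d(c, a) = d(c, A_n)}. Then for every n, the maps q_{A_n} and p_{n,n+1} ∘ q_{A_{n+1}} are homotopic within U_{2ε_n}(A_n): there exists a continuous map H : X × [0,1] → 2^X_u with H(x,0) = q_{A_n}(x), H(x,1) = p_{n,n+1}(q_{A_{n+1}}(x)), and such that for every (x,t), H(x,t) ⊆ A_n and diam(H(x,t)) < 2ε_n. -/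
open Metric Set Filter Topology

/-- The composite `p_{A,B} ∘ q_B : X → 2^X_u` of the nearest-point map `q_B` followed by
the bonding map `p` sending a set `C ⊆ B` to the nearest points of `A` to points of `C`. -/
noncomputable def bondedNearestMap {X : Type*} [MetricSpace X] (A B : Finset X)
    (hA : A.Nonempty) (hB : B.Nonempty) (x : X) : Hyper X :=
  ⟨{a | a ∈ A ∧ ∃ c, (c ∈ B ∧ dist x c = infDist x (B : Set X)) ∧
      dist c a = infDist c (A : Set X)},
    by
      obtain ⟨c, hcB, hc⟩ := B.finite_toSet.isCompact.exists_infDist_eq_dist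
        (Finset.coe_nonempty.mpr hB) x
      obtain ⟨a, haA, ha⟩ := A.finite_toSet.isCompact.exists_infDist_eq_dist
        (Finset.coe_nonempty.mpr hA) c
      exact ⟨a, haA, c, ⟨hcB, hc.symm⟩, ha.symm⟩,
    (A.finite_toSet.subset fun a ha => Finset.mem_coe.mpr ha.1).isClosed⟩

theorem Hyper.ext_carrier {Y : Type*} [TopologicalSpace Y] {C D : Hyper Y}
    (h : C.carrier = D.carrier) : C = D := by
  cases C; cases D; cases h; rfl

/-- The union of those of `C` and `D` whose conditions, `P` for `C` and `Q` for `D`, hold. -/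
def Hyper.gatedUnion {Y : Type*} [TopologicalSpace Y] (P Q : Prop) (h : P ∨ Q)
    (C D : Hyper Y) : Hyper Y :=
  ⟨{y | (P ∧ y ∈ C.carrier) ∨ (Q ∧ y ∈ D.carrier)},
    h.elim (fun hP => C.nonempty'.imp fun _ hy => Or.inl ⟨hP, hy⟩)
      (fun hQ => D.nonempty'.imp fun _ hy => Or.inr ⟨hQ, hy⟩),
    (isClosed_const.and C.closed').union (isClosed_const.and D.closed')⟩

/-- A map into the hyperspace is continuous if near each point its values are contained in
the value at that point. -/
theorem Hyper.continuous_of_eventually_subset {Z Y : Type*} [TopologicalSpace Z]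
    [TopologicalSpace Y] {F : Z → Hyper Y}
    (hF : ∀ z, ∀ᶠ w in 𝓝 z, (F w).carrier ⊆ (F z).carrier) : Continuous F := by
  refine continuous_generateFrom_iff.mpr ?_
  rintro _ ⟨U, -, rfl⟩
  refine isOpen_iff_mem_nhds.mpr fun z hz => ?_
  filter_upwards [hF z] with w hw
  exact hw.trans hz

theorem eventually_nearestMap_subset {X : Type*} [MetricSpace X] (A : Finset X)
    (hA : A.Nonempty) (x : X) :
    ∀ᶠ y in 𝓝 x, (nearestMap A hA y).carrier ⊆ (nearestMap A hA x).carrier := by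
  have key : ∀ᶠ y in 𝓝 x, ∀ a ∈ A,
      dist y a = infDist y (A : Set X) → dist x a = infDist x (A : Set X) := by
    refine (Finset.eventually_all A).mpr fun a _ => ?_
    by_cases h : dist x a = infDist x (A : Set X)
    · exact Eventually.of_forall fun _ _ => h
    · have hopen : IsOpen {y : X | dist y a ≠ infDist y (A : Set X)} :=
        isOpen_ne_fun (by fun_prop) (continuous_infDist_pt _)
      filter_upwards [hopen.mem_nhds h] with y hy h'
      exact absurd h' hy
  filter_upwards [key] with y hy a ha
  exact ⟨ha.1, hy a ha.1 ha.2⟩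

theorem eventually_bondedNearestMap_subset {X : Type*} [MetricSpace X] (A B : Finset X)
    (hA : A.Nonempty) (hB : B.Nonempty) (x : X) :
    ∀ᶠ y in 𝓝 x,
      (bondedNearestMap A B hA hB y).carrier ⊆ (bondedNearestMap A B hA hB x).carrier := by
  filter_upwards [eventually_nearestMap_subset B hB x] with y hy a ha
  obtain ⟨haA, c, hc, hca⟩ := ha
  exact ⟨haA, c, hy hc, hca⟩

theorem infDist_le_iSup_infDist {X : Type*} [MetricSpace X] [CompactSpace X]
    (s : Set X) (x : X) : infDist x s ≤ ⨆ y : X, infDist y s :=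
  le_ciSup (isCompact_range (continuous_infDist_pt s)).bddAbove x

/-- For an adjusted approximative sequence `{ε n, A n}` of a compact metric space `X`,
the nearest-point map `q_{A n}` and the composite `p_{n,n+1} ∘ q_{A (n+1)}` are homotopic
within `U_{2 ε n}(A n)`: there is a homotopy between them all of whose values are subsets
of `A n` of diameter strictly less than `2 ε n`. -/
theorem nearestMap_homotopic_bondedNearestMap
    (X : Type*) [MetricSpace X] [CompactSpace X] [Nonempty X]
    (ε : ℕ → ℝ) (A : ℕ → Finset X)
    (hdec : StrictAnti ε) (hpos : ∀ n, 0 < ε n) (hlim : Tendsto ε atTop (nhds 0))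
    (hne : ∀ n, (A n).Nonempty)
    (hγ : ∀ n, (⨆ x : X, infDist x (A n : Set X)) < ε n)
    (hadj : ∀ n, ε (n + 1) < (ε n - ⨆ x : X, infDist x (A n : Set X)) / 2) :
    ∀ n : ℕ, ∃ H : X × unitInterval → Hyper X, Continuous H ∧
      (∀ x, H (x, 0) = nearestMap (A n) (hne n) x) ∧
      (∀ x, H (x, 1) = bondedNearestMap (A n) (A (n + 1)) (hne n) (hne (n + 1)) x) ∧
      (∀ p, (H p).carrier ⊆ (A n : Set X) ∧ diam (H p).carrier < 2 * ε n) := by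
  intro n
  have gate : ∀ t : unitInterval, (t : ℝ) ≤ 1 / 2 ∨ 1 / 2 ≤ (t : ℝ) := fun t => le_total _ _
  refine ⟨fun p => Hyper.gatedUnion _ _ (gate p.2) (nearestMap (A n) (hne n) p.1)
    (bondedNearestMap (A n) (A (n + 1)) (hne n) (hne (n + 1)) p.1), ?_, ?_, ?_, ?_⟩
  · refine Hyper.continuous_of_eventually_subset ?_
    rintro ⟨x, t⟩
    have hle : ∀ᶠ s : unitInterval in 𝓝 t, (s : ℝ) ≤ 1 / 2 → (t : ℝ) ≤ 1 / 2 := by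
      by_cases h : (t : ℝ) ≤ 1 / 2
      · exact Eventually.of_forall fun _ _ => h
      · filter_upwards [continuous_subtype_val.continuousAt.eventually
          (lt_mem_nhds (not_le.mp h))] with s hs hs'
        exact absurd hs' (not_le.mpr hs)
    have hge : ∀ᶠ s : unitInterval in 𝓝 t, 1 / 2 ≤ (s : ℝ) → 1 / 2 ≤ (t : ℝ) := by
      by_cases h : 1 / 2 ≤ (t : ℝ)
      · exact Eventually.of_forall fun _ _ => h
      · filter_upwards [continuous_subtype_val.continuousAt.eventually
          (gt_mem_nhds (not_le.mp h))] with s hs hs'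
        exact absurd hs' (not_le.mpr hs)
    filter_upwards [continuous_fst.continuousAt.eventually
        (eventually_nearestMap_subset (A n) (hne n) x),
      continuous_fst.continuousAt.eventually
        (eventually_bondedNearestMap_subset (A n) (A (n + 1)) (hne n) (hne (n + 1)) x),
      continuous_snd.continuousAt.eventually hle,
      continuous_snd.continuousAt.eventually hge] with p hq hb hl hg a ha
    exact ha.imp (fun h => ⟨hl h.1, hq h.2⟩) (fun h => ⟨hg h.1, hb h.2⟩)
  · intro x
    refine Hyper.ext_carrier (Set.ext fun a => ?_)
    norm_num [Hyper.gatedUnion]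
  · intro x
    refine Hyper.ext_carrier (Set.ext fun a => ?_)
    norm_num [Hyper.gatedUnion]
  · rintro ⟨x, t⟩
    refine ⟨?_, ?_⟩
    · rintro a (ha | ha) <;> exact ha.2.1
    · have hr : ∀ a ∈ (Hyper.gatedUnion _ _ (gate t) (nearestMap (A n) (hne n) x)
          (bondedNearestMap (A n) (A (n + 1)) (hne n) (hne (n + 1)) x)).carrier,
          dist x a ≤ (⨆ y : X, infDist y (A n : Set X)) + ε (n + 1) := by
        rintro a (⟨-, -, ha⟩ | ⟨-, -, c, ⟨-, hc⟩, ha⟩)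
        · linarith [infDist_le_iSup_infDist (A n : Set X) x, hpos (n + 1)]
        · linarith [infDist_le_iSup_infDist (A n : Set X) c, hγ (n + 1),
            infDist_le_iSup_infDist (A (n + 1) : Set X) x, dist_triangle x c a]
      have hnonneg : 0 ≤ ⨆ y : X, infDist y (A n : Set X) :=
        Real.iSup_nonneg fun _ => infDist_nonneg
      refine (diam_le_of_forall_dist_le
        (C := 2 * ((⨆ y : X, infDist y (A n : Set X)) + ε (n + 1)))
        (by linarith [hpos (n + 1)]) fun a ha b hb => ?_).trans_lt
        (by linarith [hadj n, hγ n])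
      linarith [hr a ha, hr b hb, dist_triangle_left a b x]
end
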